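/- For every n ≥ 3 the following commutation relations hold (with the convention that a term with an out-of-range index is absent): for j = 0,…,n−2: [Y^j, X] = −2·YZ^j and [Z^j, X] = 2·YZ^j; [Y^j, Z^0] = 2·YZ^{j+1} for j ≤ n−3 while [Y^{n−2}, Z^0] = 0; [Z^j, Z^0] = −2·YZ^{j−1} for j ≥ 1 while [Z^0, Z^0] = 0; [YZ^j, X] = −4·Z^j + 4·Y^j; [YZ^0, Z^0] = 4·X + 4·Z^1 if n ≥ 4 (and [YZ^0, Z^0] = 4·X + 4·XX − 4·Y^0... for n = 3 use the general formula), and in general [YZ^j, Z^0] = 4·(δ_{j,0}·X − (1−δ_{j,0})·Y^{j−1} + δ_{j,n−2}·XX + (1−δ_{j,n−2})·Z^{j+1}); finally [X, X] = 0, [XX, X] = 0, [X, Z^0] = −2·YZ^0 and [XX, Z^0] = −2·YZ^{n−2}. Here δ denotes the Kronecker delta. -/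

import Mathlib

namespace Ising

noncomputable section

open Matrix

attribute [local instance 100] LieRing.ofAssociativeRing

/-- We model `2^n × 2^n` complex matrices as matrices indexed by `Fin n → Fin 2`
(the standard index type for an `n`-fold tensor product of qubits). -/
abbrev M (n : ℕ) := Matrix (Fin n → Fin 2) (Fin n → Fin 2) ℂ

/-- The Pauli matrix σx. -/
def sx : Matrix (Fin 2) (Fin 2) ℂ := !![0, 1; 1, 0]
/-- The Pauli matrix σy. -/
def sy : Matrix (Fin 2) (Fin 2) ℂ := !![0, Complex.I; -Complex.I, 0]
/-- The Pauli matrix σz. -/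
def sz : Matrix (Fin 2) (Fin 2) ℂ := !![1, 0; 0, -1]

/-- The `n`-fold Kronecker product of the `2 × 2` matrices `f 0, …, f (n-1)`. -/
def kron {n : ℕ} (f : Fin n → Matrix (Fin 2) (Fin 2) ℂ) : M n :=
  fun x y => ∏ j, f j (x j) (y j)

/-- The matrix `σ` placed in the `j`-th tensor factor, identity elsewhere (`σ^j`). -/
def pauliAt (n : ℕ) (σ : Matrix (Fin 2) (Fin 2) ℂ) (j : Fin n) : M n :=
  kron fun i => if i = j then σ else 1

/-- The permutation matrix implementing the cyclic shift of the `n` tensor factors. -/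
def P (n : ℕ) : M n :=
  fun x y => if x = (fun i => y (finRotate n i)) then 1 else 0

/-- The symmetrizer `C(A) = ∑_{k=0}^{n-1} Pᵏ A (Pᵏ)⁻¹` over the cyclic group `C_n`. -/
def symmC {n : ℕ} (A : M n) : M n :=
  ∑ k ∈ Finset.range n, P n ^ k * A * (P n ^ k)⁻¹

/-- The Pauli string `a ⊗ σx^{⊗j} ⊗ b ⊗ 1^{⊗(n-j-2)}`. -/
def str (n : ℕ) (a b : Matrix (Fin 2) (Fin 2) ℂ) (j : ℕ) : M n :=
  kron fun i => if (i : ℕ) = 0 then a else if (i : ℕ) = j + 1 then b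
    else if (i : ℕ) ≤ j then sx else 1

/-- `Y^j := i C(σy ⊗ σx^{⊗j} ⊗ σy ⊗ 1^{⊗(n-j-2)})`. -/
def Y (n j : ℕ) : M n := Complex.I • symmC (str n sy sy j)
/-- `Z^j := i C(σz ⊗ σx^{⊗j} ⊗ σz ⊗ 1^{⊗(n-j-2)})`. -/
def Z (n j : ℕ) : M n := Complex.I • symmC (str n sz sz j)
/-- `YZ^j := i C(σz ⊗ σx^{⊗j} ⊗ σy ⊗ 1^{⊗(n-j-2)}) + i C(σy ⊗ σx^{⊗j} ⊗ σz ⊗ 1^{⊗(n-j-2)})`. -/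
def YZ (n j : ℕ) : M n :=
  Complex.I • symmC (str n sz sy j) + Complex.I • symmC (str n sy sz j)
/-- `X := i C(σx ⊗ 1^{⊗(n-1)})`. -/
def X (n : ℕ) : M n :=
  Complex.I • symmC (kron fun i : Fin n => if (i : ℕ) = 0 then sx else 1)
/-- `XX := i C(σx^{⊗(n-1)} ⊗ 1)`. -/
def XX (n : ℕ) : M n :=
  Complex.I • symmC (kron fun i : Fin n => if (i : ℕ) = n - 1 then 1 else sx)

/-- `H0 = ∑_{j=1}^{n-1} σz^j σz^{j+1} + σz^n σz^1` (cyclically next neighbours). -/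
def H0 (n : ℕ) : M n := ∑ j : Fin n, pauliAt n sz j * pauliAt n sz (finRotate n j)
/-- `H1 = ∑_{j=1}^{n} σx^j`. -/
def H1 (n : ℕ) : M n := ∑ j : Fin n, pauliAt n sx j

/-- The dynamical Lie algebra: the smallest real Lie subalgebra of the `2^n × 2^n`
complex matrices (with the commutator bracket) containing `i•H0` and `i•H1`. -/
def DLA (n : ℕ) : LieSubalgebra ℝ (M n) :=
  LieSubalgebra.lieSpan ℝ (M n) {Complex.I • H0 n, Complex.I • H1 n}


/-! ### Helper lemmas -/

set_option linter.unusedSimpArgs false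

lemma kron_mul {n : ℕ} (f g : Fin n → Matrix (Fin 2) (Fin 2) ℂ) :
    kron f * kron g = kron (fun i => f i * g i) := by
  ext x y
  simp only [kron, Matrix.mul_apply]
  rw [Finset.prod_univ_sum]
  simp [Finset.prod_mul_distrib]

lemma kron_smul {n : ℕ} (f g : Fin n → Matrix (Fin 2) (Fin 2) ℂ) (s : Fin n) (c : ℂ)
    (hs : f s = c • g s) (h : ∀ i, i ≠ s → f i = g i) : kron f = c • kron g := by
  ext x y
  simp only [kron, Matrix.smul_apply, smul_eq_mul]
  rw [← Finset.mul_prod_erase _ _ (Finset.mem_univ s),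
    ← Finset.mul_prod_erase Finset.univ (fun j => g j (x j) (y j)) (Finset.mem_univ s), hs]
  rw [Finset.prod_congr rfl (fun i hi => by rw [h i (Finset.ne_of_mem_erase hi)])]
  simp [mul_assoc]

/-- Next site on the ring. -/
def nx (n i : ℕ) : ℕ := if i + 1 = n then 0 else i + 1
/-- Previous site on the ring. -/
def pv (n i : ℕ) : ℕ := if i = 0 then n - 1 else i - 1

lemma nx_cases (n i : ℕ) : (i + 1 = n ∧ nx n i = 0) ∨ (i + 1 ≠ n ∧ nx n i = i + 1) := by
  unfold nx; split_ifs with h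
  · exact Or.inl ⟨h, rfl⟩
  · exact Or.inr ⟨h, rfl⟩

lemma pv_cases (n i : ℕ) : (i = 0 ∧ pv n i = n - 1) ∨ (i ≠ 0 ∧ pv n i = i - 1) := by
  unfold pv; split_ifs with h
  · exact Or.inl ⟨h, rfl⟩
  · exact Or.inr ⟨h, rfl⟩

lemma rot_val (n : ℕ) (i : Fin n) : ((finRotate n i : Fin n) : ℕ) = nx n i := by
  cases n with
  | zero => exact i.elim0
  | succ n =>
    rw [coe_finRotate]
    unfold nx
    simp only [Fin.ext_iff, Fin.val_last, Nat.add_right_cancel_iff]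

lemma rot_pow_val (n k : ℕ) (i : Fin n) :
    (((finRotate n ^ k) i : Fin n) : ℕ) = (i + k) % n := by
  induction k with
  | zero => simp [Nat.mod_eq_of_lt i.2]
  | succ k ih =>
    rw [pow_succ', Equiv.Perm.mul_apply, rot_val, ih, nx, ← add_assoc, Nat.add_mod (i + k) 1]
    have hn : 0 < n := i.pos
    have := Nat.mod_lt (i + k) hn
    split_ifs with h
    · rcases Nat.lt_or_ge 1 n with h1 | h1
      · rw [Nat.mod_eq_of_lt h1, h, Nat.mod_self]
      · have : n = 1 := by omega
        subst this; simp [Nat.mod_one]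
    · have h1 : (1 : ℕ) % n = 1 := Nat.mod_eq_of_lt (by omega)
      rw [h1, Nat.mod_eq_of_lt (a := (i + k) % n + 1) (by omega)]

lemma rot_pow_n (n : ℕ) : finRotate n ^ n = 1 := by
  ext i
  rw [rot_pow_val]
  simp [Nat.mod_eq_of_lt i.2]

lemma P_pow (n k : ℕ) (x y : Fin n → Fin 2) : (P n ^ k) x y =
    if x = (fun i => y ((finRotate n ^ k) i)) then 1 else 0 := by
  induction k generalizing x y with
  | zero => simp [Matrix.one_apply]
  | succ k ih =>
    rw [pow_succ, Matrix.mul_apply]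
    simp only [ih]
    simp only [P, mul_ite, mul_one, mul_zero]
    rw [Finset.sum_ite_eq' ]
    simp [pow_succ', Equiv.Perm.mul_apply]

lemma P_pow_n (n : ℕ) : P n ^ n = 1 := by
  ext x y
  rw [P_pow, rot_pow_n]
  simp [Matrix.one_apply]; rfl

lemma P_unit {n : ℕ} (hn : 0 < n) : IsUnit (P n).det := by
  have h : (P n).det ^ n = 1 := by rw [← Matrix.det_pow, P_pow_n, Matrix.det_one]
  exact IsUnit.of_pow_eq_one h hn.ne'

lemma P_kron {n : ℕ} (k : ℕ) (f : Fin n → Matrix (Fin 2) (Fin 2) ℂ) :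
    P n ^ k * kron f = kron (fun i => f ((finRotate n ^ k) i)) * P n ^ k := by
  ext x y
  rw [Matrix.mul_apply, Matrix.mul_apply]
  simp only [P_pow, mul_ite, mul_one, mul_zero, ite_mul, one_mul, zero_mul]
  rw [Finset.sum_ite_eq']
  have : ∀ w : Fin n → Fin 2, (x = fun i => w ((finRotate n ^ k) i)) ↔
      w = fun i => x ((finRotate n ^ k)⁻¹ i) := by
    intro w
    constructor
    · rintro rfl; ext i; simp
    · rintro rfl; ext i; simp
  simp only [this]
  rw [Finset.sum_ite_eq']
  simp only [Finset.mem_univ, if_true, kron]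
  rw [← Equiv.prod_comp (finRotate n ^ k)]
  simp

lemma symmC_eq {n : ℕ} (A : M n) :
    symmC A = ∑ k ∈ Finset.range n, P n ^ k * A * (P n)⁻¹ ^ k := by
  simp [symmC, Matrix.inv_pow']

lemma symmC_kron {n : ℕ} (hn : 0 < n) (f : ℕ → Matrix (Fin 2) (Fin 2) ℂ) :
    symmC (kron fun i : Fin n => f i) =
      ∑ k ∈ Finset.range n, kron fun i : Fin n => f ((i + k) % n) := by
  unfold symmC
  refine Finset.sum_congr rfl fun k _ => ?_
  rw [P_kron, Matrix.mul_nonsing_inv_cancel_right]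
  · simp only [rot_pow_val]
  · rw [Matrix.det_pow]; exact (P_unit hn).pow k

lemma sum_cyc {A : Type*} [AddCommGroup A] (n : ℕ) (g : ℕ → A) (h : g n = g 0) :
    ∑ k ∈ Finset.range n, g (k + 1) = ∑ k ∈ Finset.range n, g k := by
  have h1 := Finset.sum_range_succ g n
  have h2 := Finset.sum_range_succ' g n
  rw [h1, h] at h2
  exact (add_right_cancel h2).symm

lemma nx_mod {n : ℕ} (i k : ℕ) (hn : 0 < n) : nx n ((i + k) % n) = (i + (k + 1)) % n := by
  have h := rot_pow_val n (k + 1) ⟨i % n, Nat.mod_lt _ hn⟩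
  rw [pow_succ', Equiv.Perm.mul_apply, rot_val, rot_pow_val] at h
  simpa using h

lemma symmC_nx {n : ℕ} (hn : 0 < n) (f : ℕ → Matrix (Fin 2) (Fin 2) ℂ) :
    symmC (kron fun i : Fin n => f (nx n i)) = symmC (kron fun i : Fin n => f i) := by
  rw [symmC_kron hn f, symmC_kron hn (fun i => f (nx n i))]
  simp only [nx_mod _ _ hn]
  exact sum_cyc n (fun k => kron fun i : Fin n => f ((i + k) % n)) (by simp)

lemma symmC_pv {n : ℕ} (hn : 0 < n) (f : ℕ → Matrix (Fin 2) (Fin 2) ℂ) :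
    symmC (kron fun i : Fin n => f (pv n i)) = symmC (kron fun i : Fin n => f i) := by
  rw [← symmC_nx hn (fun i => f (pv n i))]
  congr 2
  ext1 i
  have : pv n (nx n i) = i := by
    have := i.2
    have h1 := nx_cases n i
    have h2 := pv_cases n (nx n i)
    omega
  rw [this]

lemma P_conj_symmC {n : ℕ} (hn : 0 < n) (A : M n) : P n * symmC A = symmC A * P n := by
  have hu := P_unit hn
  rw [symmC_eq, Finset.mul_sum, Finset.sum_mul]
  rw [← sum_cyc n (fun k => P n ^ k * A * (P n)⁻¹ ^ k * P n)]
  · refine Finset.sum_congr rfl fun k _ => ?_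
    rw [pow_succ', pow_succ (P n)⁻¹]
    simp only [mul_assoc]
    rw [Matrix.nonsing_inv_mul _ hu, mul_one]
  · simp [Matrix.inv_pow', P_pow_n]

lemma lie_symmC {n : ℕ} (hn : 0 < n) (A B : M n) :
    ⁅Complex.I • symmC A, Complex.I • symmC B⁆ = - symmC ⁅A, symmC B⁆ := by
  have hu := P_unit hn
  have hc : Commute (P n) (symmC B) := P_conj_symmC hn B
  have hc' : ∀ k, P n ^ k * symmC B = symmC B * P n ^ k := fun k => (hc.pow_left k)
  have hi : Commute ((P n)⁻¹) (symmC B) := by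
    have h1 : (P n)⁻¹ * (P n * symmC B) * (P n)⁻¹ = (P n)⁻¹ * (symmC B * P n) * (P n)⁻¹ := by
      rw [P_conj_symmC hn B]
    rw [← mul_assoc, Matrix.nonsing_inv_mul _ hu, one_mul, ← mul_assoc, mul_assoc _ (P n),
      Matrix.mul_nonsing_inv _ hu, mul_one] at h1
    exact h1.symm
  have hi' : ∀ k, (P n)⁻¹ ^ k * symmC B = symmC B * (P n)⁻¹ ^ k := fun k => (hi.pow_left k)
  generalize symmC B = H at *
  rw [Ring.lie_def, smul_mul_smul_comm, smul_mul_smul_comm, ← smul_sub, Complex.I_mul_I, neg_one_smul,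
    symmC_eq, symmC_eq, Finset.sum_mul, Finset.mul_sum, ← Finset.sum_sub_distrib]
  congr 1
  refine Finset.sum_congr rfl fun k _ => ?_
  rw [Ring.lie_def, mul_sub, sub_mul]
  congr 1
  · simp only [mul_assoc, hi']
  · simp only [← mul_assoc, hc']

lemma symmC_add {n : ℕ} (A B : M n) : symmC (A + B) = symmC A + symmC B := by
  simp [symmC, mul_add, add_mul, Finset.sum_add_distrib]

lemma symmC_smul {n : ℕ} (c : ℂ) (A : M n) : symmC (c • A) = c • symmC A := by
  simp [symmC, Finset.smul_sum]

lemma symmC_zero {n : ℕ} : symmC (0 : M n) = 0 := by simp [symmC]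

/-- Sites of `σx`. -/
def qx (m i : ℕ) : Matrix (Fin 2) (Fin 2) ℂ := if i = m then sx else 1
/-- Bond `m, m+1`. -/
def qz (n m i : ℕ) : Matrix (Fin 2) (Fin 2) ℂ := if i = m ∨ i = nx n m then sz else 1

/-- String function. -/
def S (a b : Matrix (Fin 2) (Fin 2) ℂ) (j i : ℕ) : Matrix (Fin 2) (Fin 2) ℂ :=
  if i = 0 then a else if i = j + 1 then b else if i ≤ j then sx else 1

/-- natural-number indexed Kronecker product. -/
def kr (n : ℕ) (f : ℕ → Matrix (Fin 2) (Fin 2) ℂ) : M n := kron fun i : Fin n => f i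

lemma str_eq (n : ℕ) (a b : Matrix (Fin 2) (Fin 2) ℂ) (j : ℕ) : str n a b j = kr n (S a b j) := rfl

lemma mod_lem {n : ℕ} (i m : ℕ) (hi : i < n) (hm : m < n) :
    (i + (n - 1 - m)) % n = if i ≤ m then i + (n - 1 - m) else i - m - 1 := by
  split_ifs with h
  · exact Nat.mod_eq_of_lt (by omega)
  · rw [Nat.mod_eq_sub_mod (by omega), Nat.mod_eq_of_lt (by omega)]; omega

lemma symmC_x {n : ℕ} (hn : 3 ≤ n) :
    symmC (kr n (qx 0)) = ∑ m ∈ Finset.range n, kr n (qx m) := by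
  unfold kr
  rw [← symmC_nx (by omega) (qx 0), symmC_kron (by omega) (fun i => qx 0 (nx n i)),
    ← Finset.sum_range_reflect]
  refine Finset.sum_congr rfl fun m hm => ?_
  congr 1
  ext1 i
  have := i.2
  rw [Finset.mem_range] at hm
  have h0 := mod_lem (n := n) i m i.2 hm
  have h1 := nx_cases n ((i + (n - 1 - m)) % n)
  unfold qx
  congr 1
  apply propext
  split_ifs at h0 <;> omega

lemma symmC_z {n : ℕ} (hn : 3 ≤ n) :
    symmC (str n sz sz 0) = ∑ m ∈ Finset.range n, kr n (qz n m) := by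
  have : S sz sz 0 = qz n 0 := by
    ext1 i
    unfold S qz nx
    split_ifs <;> first | rfl | omega
  rw [str_eq, this]
  unfold kr
  rw [← symmC_nx (by omega) (qz n 0), symmC_kron (by omega) (fun i => qz n 0 (nx n i)),
    ← Finset.sum_range_reflect]
  refine Finset.sum_congr rfl fun m hm => ?_
  congr 1
  ext1 i
  have := i.2
  rw [Finset.mem_range] at hm
  have h0 := mod_lem (n := n) i m i.2 hm
  have h1 := nx_cases n ((i + (n - 1 - m)) % n)
  have h2 := nx_cases n 0
  have h3 := nx_cases n m
  unfold qz
  congr 1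
  apply propext
  split_ifs at h0 <;> omega

lemma kr_lie {n : ℕ} (f q g : ℕ → Matrix (Fin 2) (Fin 2) ℂ) (s : ℕ) (c : ℂ) (hs : s < n)
    (h1 : f s * q s = c • g s) (h2 : q s * f s = (-c) • g s)
    (h3 : ∀ i < n, i ≠ s → f i * q i = g i ∧ q i * f i = g i) :
    ⁅kr n f, kr n q⁆ = (2 * c) • kr n g := by
  rw [Ring.lie_def]
  unfold kr
  rw [kron_mul, kron_mul,
    kron_smul (fun i : Fin n => f i * q i) (fun i => g i) ⟨s, hs⟩ c h1
      (fun i hi => (h3 i i.2 (fun h => hi (Fin.ext h))).1),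
    kron_smul (fun i : Fin n => q i * f i) (fun i => g i) ⟨s, hs⟩ (-c) h2
      (fun i hi => (h3 i i.2 (fun h => hi (Fin.ext h))).2), ← sub_smul]
  congr 1; ring

lemma kr_lie_comm {n : ℕ} (f q : ℕ → Matrix (Fin 2) (Fin 2) ℂ)
    (h : ∀ i < n, f i * q i = q i * f i) : ⁅kr n f, kr n q⁆ = 0 := by
  rw [Ring.lie_def]
  unfold kr
  rw [kron_mul, kron_mul, sub_eq_zero]
  congr 1
  ext1 i
  exact h i i.2

lemma kr_lie_anti {n : ℕ} (f q : ℕ → Matrix (Fin 2) (Fin 2) ℂ) (s t : ℕ) (hs : s < n) (ht : t < n)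
    (hst : s ≠ t) (h1 : f s * q s = - (q s * f s)) (h2 : f t * q t = - (q t * f t))
    (h : ∀ i < n, i ≠ s → i ≠ t → f i * q i = q i * f i) : ⁅kr n f, kr n q⁆ = 0 := by
  rw [Ring.lie_def]
  unfold kr
  rw [kron_mul, kron_mul, sub_eq_zero]
  rw [kron_smul (fun i : Fin n => f i * q i)
      (fun i => if (i : ℕ) = s then q i * f i else f i * q i) ⟨s, hs⟩ (-1) (by simp [h1])
      (fun i hi => by rw [if_neg (fun h => hi (Fin.ext h))]),
    kron_smul (fun i : Fin n => if (i : ℕ) = s then q i * f i else f i * q i)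
      (fun i => q i * f i) ⟨t, ht⟩ (-1) (by simp [h2, hst.symm])
      (fun i hi => ?_)]
  · simp
  · have hi' : (i : ℕ) ≠ t := fun h => hi (Fin.ext h)
    split_ifs with h'
    · rfl
    · exact h i i.2 h' hi'

lemma sxx : sx * sx = 1 := by ext i j; fin_cases i <;> fin_cases j <;> simp [sx]
lemma syy : sy * sy = 1 := by ext i j; fin_cases i <;> fin_cases j <;> simp [sy]
lemma szz : sz * sz = 1 := by ext i j; fin_cases i <;> fin_cases j <;> simp [sz]
lemma sxy : sx * sy = (-Complex.I) • sz := by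
  ext i j; fin_cases i <;> fin_cases j <;> simp [sx, sy, sz]
lemma syx : sy * sx = Complex.I • sz := by
  ext i j; fin_cases i <;> fin_cases j <;> simp [sx, sy, sz]
lemma syz : sy * sz = (-Complex.I) • sx := by
  ext i j; fin_cases i <;> fin_cases j <;> simp [sx, sy, sz]
lemma szy : sz * sy = Complex.I • sx := by
  ext i j; fin_cases i <;> fin_cases j <;> simp [sx, sy, sz]
lemma szx : sz * sx = (-Complex.I) • sy := by
  ext i j; fin_cases i <;> fin_cases j <;> simp [sx, sy, sz]
lemma sxz : sx * sz = Complex.I • sy := by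
  ext i j; fin_cases i <;> fin_cases j <;> simp [sx, sy, sz]

lemma two_terms {n : ℕ} (A : M n) (q : ℕ → M n) (a b : ℕ) (ha : a < n) (hb : b < n) (hab : a ≠ b)
    (U V : M n) (hU : ⁅A, q a⁆ = U) (hV : ⁅A, q b⁆ = V)
    (h : ∀ m < n, m ≠ a → m ≠ b → ⁅A, q m⁆ = 0) :
    ⁅A, ∑ m ∈ Finset.range n, q m⁆ = U + V := by
  rw [lie_sum, Finset.sum_eq_add_of_mem a b (Finset.mem_range.2 ha) (Finset.mem_range.2 hb) hab, hU, hV]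
  intro c hc hh
  exact h c (Finset.mem_range.1 hc) hh.1 hh.2

/-- Vanishing of the commutator with a bond. -/
lemma bond_zero {n : ℕ} (hn : 3 ≤ n) (f : ℕ → Matrix (Fin 2) (Fin 2) ℂ) (m : ℕ) (hm : m < n)
    (h : (f m * sz = sz * f m ∧ f (nx n m) * sz = sz * f (nx n m)) ∨
      (f m * sz = -(sz * f m) ∧ f (nx n m) * sz = -(sz * f (nx n m)))) :
    ⁅kr n f, kr n (qz n m)⁆ = 0 := by
  have hne : m ≠ nx n m := by unfold nx; split_ifs <;> omega
  have hlt : nx n m < n := by unfold nx; split_ifs <;> omega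
  rcases h with ⟨h1, h2⟩ | ⟨h1, h2⟩
  · apply kr_lie_comm
    intro i _
    unfold qz
    split_ifs with h
    · rcases h with rfl | rfl <;> assumption
    · simp
  · apply kr_lie_anti _ _ m (nx n m) hm hlt hne
    · simpa [qz] using h1
    · simpa [qz] using h2
    · intro i _ h3 h4
      simp [qz, h3, h4]

/-- The function of `XX`. -/
def fXX (n i : ℕ) : Matrix (Fin 2) (Fin 2) ℂ := if i = n - 1 then 1 else sx

lemma lieX {n : ℕ} (hn : 3 ≤ n) (j : ℕ) (hj : j ≤ n - 2) (a b a' b' : Matrix (Fin 2) (Fin 2) ℂ)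
    (c d : ℂ) (ha : a * sx = c • a') (ha' : sx * a = (-c) • a')
    (hb : b * sx = d • b') (hb' : sx * b = (-d) • b') :
    ⁅Complex.I • symmC (str n a b j), X n⁆ =
      -((2 * c) • symmC (str n a' b j) + (2 * d) • symmC (str n a b' j)) := by
  have hX : X n = Complex.I • symmC (kr n (qx 0)) := rfl
  rw [hX, lie_symmC (by omega), symmC_x hn, ← symmC_smul, ← symmC_smul, ← symmC_add]
  congr 2
  simp only [str_eq]
  apply two_terms _ _ 0 (j + 1) (by omega) (by omega) (by omega)
  · refine kr_lie _ _ _ 0 c (by omega) ?_ ?_ ?_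
    · simpa [S, qx] using ha
    · simpa [S, qx] using ha'
    · intro i _ hi
      simp [S, qx, hi]
  · refine kr_lie _ _ _ (j + 1) d (by omega) ?_ ?_ ?_
    · simpa [S, qx] using hb
    · simpa [S, qx] using hb'
    · intro i _ hi
      simp [S, qx, hi]
  · intro m _ h1 h2
    apply kr_lie_comm
    intro i _
    unfold S qx
    split_ifs <;> first | (exfalso; omega) | simp

lemma b_yy1 {n : ℕ} (hn : 3 ≤ n) (j : ℕ) (hj : j ≤ n - 3) :
    ⁅kr n (S sy sy j), kr n (qz n (n - 1))⁆ = (2 * (-Complex.I)) • kr n (fun i => (S sz sy (j + 1)) (nx n i)) := by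
  refine kr_lie _ _ _ (0) ((-Complex.I)) (by omega) ?_ ?_ ?_
  · have h0 := nx_cases n (n - 1)
    have h1 := nx_cases n (0)
    unfold S qz
    split_ifs <;> first | (exfalso; omega) | simp [sxx, syy, szz, sxy, syx, syz, szy, szx, sxz]
  · have h0 := nx_cases n (n - 1)
    have h1 := nx_cases n (0)
    unfold S qz
    split_ifs <;> first | (exfalso; omega) | simp [sxx, syy, szz, sxy, syx, syz, szy, szx, sxz]
  · intro i hin hi
    have h0 := nx_cases n (n - 1)
    have h1 := nx_cases n i
    unfold S qz
    split_ifs <;> first | (exfalso; omega) | simp [sxx, syy, szz, sxy, syx, syz, szy, szx, sxz]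

lemma b_yy2 {n : ℕ} (hn : 3 ≤ n) (j : ℕ) (hj : j ≤ n - 3) :
    ⁅kr n (S sy sy j), kr n (qz n (j + 1))⁆ = (2 * (-Complex.I)) • kr n (S sy sz (j + 1)) := by
  refine kr_lie _ _ _ (j + 1) ((-Complex.I)) (by omega) ?_ ?_ ?_
  · have h0 := nx_cases n (j + 1)
    unfold S qz
    split_ifs <;> first | (exfalso; omega) | simp [sxx, syy, szz, sxy, syx, syz, szy, szx, sxz]
  · have h0 := nx_cases n (j + 1)
    unfold S qz
    split_ifs <;> first | (exfalso; omega) | simp [sxx, syy, szz, sxy, syx, syz, szy, szx, sxz]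
  · intro i hin hi
    have h0 := nx_cases n (j + 1)
    unfold S qz
    split_ifs <;> first | (exfalso; omega) | simp [sxx, syy, szz, sxy, syx, syz, szy, szx, sxz]

lemma b_zz1 {n : ℕ} (hn : 3 ≤ n) (j : ℕ) (hj1 : 1 ≤ j) (hj : j ≤ n - 2) :
    ⁅kr n (S sz sz j), kr n (qz n (0))⁆ = (2 * Complex.I) • kr n (fun i => (S sy sz (j - 1)) (pv n i)) := by
  refine kr_lie _ _ _ (1) (Complex.I) (by omega) ?_ ?_ ?_
  · have h0 := nx_cases n (0)
    have h1 := pv_cases n (1)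
    unfold S qz
    split_ifs <;> first | (exfalso; omega) | simp [sxx, syy, szz, sxy, syx, syz, szy, szx, sxz]
  · have h0 := nx_cases n (0)
    have h1 := pv_cases n (1)
    unfold S qz
    split_ifs <;> first | (exfalso; omega) | simp [sxx, syy, szz, sxy, syx, syz, szy, szx, sxz]
  · intro i hin hi
    have h0 := nx_cases n (0)
    have h1 := pv_cases n i
    unfold S qz
    split_ifs <;> first | (exfalso; omega) | simp [sxx, syy, szz, sxy, syx, syz, szy, szx, sxz]

lemma b_zz2 {n : ℕ} (hn : 3 ≤ n) (j : ℕ) (hj1 : 1 ≤ j) (hj : j ≤ n - 2) :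
    ⁅kr n (S sz sz j), kr n (qz n (j))⁆ = (2 * Complex.I) • kr n (S sz sy (j - 1)) := by
  refine kr_lie _ _ _ (j) (Complex.I) (by omega) ?_ ?_ ?_
  · have h0 := nx_cases n (j)
    unfold S qz
    split_ifs <;> first | (exfalso; omega) | simp [sxx, syy, szz, sxy, syx, syz, szy, szx, sxz]
  · have h0 := nx_cases n (j)
    unfold S qz
    split_ifs <;> first | (exfalso; omega) | simp [sxx, syy, szz, sxy, syx, syz, szy, szx, sxz]
  · intro i hin hi
    have h0 := nx_cases n (j)
    unfold S qz
    split_ifs <;> first | (exfalso; omega) | simp [sxx, syy, szz, sxy, syx, syz, szy, szx, sxz]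

lemma b_zy1 {n : ℕ} (hn : 3 ≤ n) :
    ⁅kr n (S sz sy 0), kr n (qz n (0))⁆ = (2 * (-Complex.I)) • kr n (fun i => (qx 0) (pv n i)) := by
  refine kr_lie _ _ _ (1) ((-Complex.I)) (by omega) ?_ ?_ ?_
  · have h0 := nx_cases n (0)
    have h1 := pv_cases n (1)
    unfold S qz qx
    split_ifs <;> first | (exfalso; omega) | simp [sxx, syy, szz, sxy, syx, syz, szy, szx, sxz]
  · have h0 := nx_cases n (0)
    have h1 := pv_cases n (1)
    unfold S qz qx
    split_ifs <;> first | (exfalso; omega) | simp [sxx, syy, szz, sxy, syx, syz, szy, szx, sxz]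
  · intro i hin hi
    have h0 := nx_cases n (0)
    have h1 := pv_cases n i
    unfold S qz qx
    split_ifs <;> first | (exfalso; omega) | simp [sxx, syy, szz, sxy, syx, syz, szy, szx, sxz]

lemma b_zy2 {n : ℕ} (hn : 3 ≤ n) (j : ℕ) (hj1 : 1 ≤ j) (hj : j ≤ n - 2) :
    ⁅kr n (S sz sy j), kr n (qz n (0))⁆ = (2 * Complex.I) • kr n (fun i => (S sy sy (j - 1)) (pv n i)) := by
  refine kr_lie _ _ _ (1) (Complex.I) (by omega) ?_ ?_ ?_
  · have h0 := nx_cases n (0)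
    have h1 := pv_cases n (1)
    unfold S qz
    split_ifs <;> first | (exfalso; omega) | simp [sxx, syy, szz, sxy, syx, syz, szy, szx, sxz]
  · have h0 := nx_cases n (0)
    have h1 := pv_cases n (1)
    unfold S qz
    split_ifs <;> first | (exfalso; omega) | simp [sxx, syy, szz, sxy, syx, syz, szy, szx, sxz]
  · intro i hin hi
    have h0 := nx_cases n (0)
    have h1 := pv_cases n i
    unfold S qz
    split_ifs <;> first | (exfalso; omega) | simp [sxx, syy, szz, sxy, syx, syz, szy, szx, sxz]

lemma b_zy3 {n : ℕ} (hn : 3 ≤ n) (j : ℕ) (hj : j ≤ n - 3) :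
    ⁅kr n (S sz sy j), kr n (qz n (j + 1))⁆ = (2 * (-Complex.I)) • kr n (S sz sz (j + 1)) := by
  refine kr_lie _ _ _ (j + 1) ((-Complex.I)) (by omega) ?_ ?_ ?_
  · have h0 := nx_cases n (j + 1)
    unfold S qz
    split_ifs <;> first | (exfalso; omega) | simp [sxx, syy, szz, sxy, syx, syz, szy, szx, sxz]
  · have h0 := nx_cases n (j + 1)
    unfold S qz
    split_ifs <;> first | (exfalso; omega) | simp [sxx, syy, szz, sxy, syx, syz, szy, szx, sxz]
  · intro i hin hi
    have h0 := nx_cases n (j + 1)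
    unfold S qz
    split_ifs <;> first | (exfalso; omega) | simp [sxx, syy, szz, sxy, syx, syz, szy, szx, sxz]

lemma b_zy4 {n : ℕ} (hn : 3 ≤ n) :
    ⁅kr n (S sz sy (n - 2)), kr n (qz n (n - 1))⁆ = (2 * (-Complex.I)) • kr n (fun i => (fXX n) (pv n i)) := by
  refine kr_lie _ _ _ (n - 1) ((-Complex.I)) (by omega) ?_ ?_ ?_
  · have h0 := nx_cases n (n - 1)
    have h1 := pv_cases n (n - 1)
    unfold S qz fXX
    split_ifs <;> first | (exfalso; omega) | simp [sxx, syy, szz, sxy, syx, syz, szy, szx, sxz]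
  · have h0 := nx_cases n (n - 1)
    have h1 := pv_cases n (n - 1)
    unfold S qz fXX
    split_ifs <;> first | (exfalso; omega) | simp [sxx, syy, szz, sxy, syx, syz, szy, szx, sxz]
  · intro i hin hi
    have h0 := nx_cases n (n - 1)
    have h1 := pv_cases n i
    unfold S qz fXX
    split_ifs <;> first | (exfalso; omega) | simp [sxx, syy, szz, sxy, syx, syz, szy, szx, sxz]

lemma b_yz1 {n : ℕ} (hn : 3 ≤ n) :
    ⁅kr n (S sy sz 0), kr n (qz n (0))⁆ = (2 * (-Complex.I)) • kr n (qx 0) := by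
  refine kr_lie _ _ _ (0) ((-Complex.I)) (by omega) ?_ ?_ ?_
  · have h0 := nx_cases n (0)
    unfold S qz qx
    split_ifs <;> first | (exfalso; omega) | simp [sxx, syy, szz, sxy, syx, syz, szy, szx, sxz]
  · have h0 := nx_cases n (0)
    unfold S qz qx
    split_ifs <;> first | (exfalso; omega) | simp [sxx, syy, szz, sxy, syx, syz, szy, szx, sxz]
  · intro i hin hi
    have h0 := nx_cases n (0)
    unfold S qz qx
    split_ifs <;> first | (exfalso; omega) | simp [sxx, syy, szz, sxy, syx, syz, szy, szx, sxz]

lemma b_yz2 {n : ℕ} (hn : 3 ≤ n) (j : ℕ) (hj1 : 1 ≤ j) (hj : j ≤ n - 2) :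
    ⁅kr n (S sy sz j), kr n (qz n (j))⁆ = (2 * Complex.I) • kr n (S sy sy (j - 1)) := by
  refine kr_lie _ _ _ (j) (Complex.I) (by omega) ?_ ?_ ?_
  · have h0 := nx_cases n (j)
    unfold S qz
    split_ifs <;> first | (exfalso; omega) | simp [sxx, syy, szz, sxy, syx, syz, szy, szx, sxz]
  · have h0 := nx_cases n (j)
    unfold S qz
    split_ifs <;> first | (exfalso; omega) | simp [sxx, syy, szz, sxy, syx, syz, szy, szx, sxz]
  · intro i hin hi
    have h0 := nx_cases n (j)
    unfold S qz
    split_ifs <;> first | (exfalso; omega) | simp [sxx, syy, szz, sxy, syx, syz, szy, szx, sxz]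

lemma b_yz3 {n : ℕ} (hn : 3 ≤ n) (j : ℕ) (hj : j ≤ n - 3) :
    ⁅kr n (S sy sz j), kr n (qz n (n - 1))⁆ = (2 * (-Complex.I)) • kr n (fun i => (S sz sz (j + 1)) (nx n i)) := by
  refine kr_lie _ _ _ (0) ((-Complex.I)) (by omega) ?_ ?_ ?_
  · have h0 := nx_cases n (n - 1)
    have h1 := nx_cases n (0)
    unfold S qz
    split_ifs <;> first | (exfalso; omega) | simp [sxx, syy, szz, sxy, syx, syz, szy, szx, sxz]
  · have h0 := nx_cases n (n - 1)
    have h1 := nx_cases n (0)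
    unfold S qz
    split_ifs <;> first | (exfalso; omega) | simp [sxx, syy, szz, sxy, syx, syz, szy, szx, sxz]
  · intro i hin hi
    have h0 := nx_cases n (n - 1)
    have h1 := nx_cases n i
    unfold S qz
    split_ifs <;> first | (exfalso; omega) | simp [sxx, syy, szz, sxy, syx, syz, szy, szx, sxz]

lemma b_yz4 {n : ℕ} (hn : 3 ≤ n) :
    ⁅kr n (S sy sz (n - 2)), kr n (qz n (n - 1))⁆ = (2 * (-Complex.I)) • kr n (fXX n) := by
  refine kr_lie _ _ _ (0) ((-Complex.I)) (by omega) ?_ ?_ ?_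
  · have h0 := nx_cases n (n - 1)
    unfold S qz fXX
    split_ifs <;> first | (exfalso; omega) | simp [sxx, syy, szz, sxy, syx, syz, szy, szx, sxz]
  · have h0 := nx_cases n (n - 1)
    unfold S qz fXX
    split_ifs <;> first | (exfalso; omega) | simp [sxx, syy, szz, sxy, syx, syz, szy, szx, sxz]
  · intro i hin hi
    have h0 := nx_cases n (n - 1)
    unfold S qz fXX
    split_ifs <;> first | (exfalso; omega) | simp [sxx, syy, szz, sxy, syx, syz, szy, szx, sxz]

lemma b_x1 {n : ℕ} (hn : 3 ≤ n) :
    ⁅kr n (qx 0), kr n (qz n (n - 1))⁆ = (2 * Complex.I) • kr n (fun i => (S sz sy 0) (nx n i)) := by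
  refine kr_lie _ _ _ (0) (Complex.I) (by omega) ?_ ?_ ?_
  · have h0 := nx_cases n (n - 1)
    have h1 := nx_cases n (0)
    unfold S qz qx
    split_ifs <;> first | (exfalso; omega) | simp [sxx, syy, szz, sxy, syx, syz, szy, szx, sxz]
  · have h0 := nx_cases n (n - 1)
    have h1 := nx_cases n (0)
    unfold S qz qx
    split_ifs <;> first | (exfalso; omega) | simp [sxx, syy, szz, sxy, syx, syz, szy, szx, sxz]
  · intro i hin hi
    have h0 := nx_cases n (n - 1)
    have h1 := nx_cases n i
    unfold S qz qx
    split_ifs <;> first | (exfalso; omega) | simp [sxx, syy, szz, sxy, syx, syz, szy, szx, sxz]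

lemma b_x2 {n : ℕ} (hn : 3 ≤ n) :
    ⁅kr n (qx 0), kr n (qz n (0))⁆ = (2 * Complex.I) • kr n (S sy sz 0) := by
  refine kr_lie _ _ _ (0) (Complex.I) (by omega) ?_ ?_ ?_
  · have h0 := nx_cases n (0)
    unfold S qz qx
    split_ifs <;> first | (exfalso; omega) | simp [sxx, syy, szz, sxy, syx, syz, szy, szx, sxz]
  · have h0 := nx_cases n (0)
    unfold S qz qx
    split_ifs <;> first | (exfalso; omega) | simp [sxx, syy, szz, sxy, syx, syz, szy, szx, sxz]
  · intro i hin hi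
    have h0 := nx_cases n (0)
    unfold S qz qx
    split_ifs <;> first | (exfalso; omega) | simp [sxx, syy, szz, sxy, syx, syz, szy, szx, sxz]

lemma b_xx1 {n : ℕ} (hn : 3 ≤ n) :
    ⁅kr n (fXX n), kr n (qz n (n - 2))⁆ = (2 * Complex.I) • kr n (fun i => (S sz sy (n - 2)) (nx n i)) := by
  refine kr_lie _ _ _ (n - 2) (Complex.I) (by omega) ?_ ?_ ?_
  · have h0 := nx_cases n (n - 2)
    have h1 := nx_cases n (n - 2)
    unfold S qz fXX
    split_ifs <;> first | (exfalso; omega) | simp [sxx, syy, szz, sxy, syx, syz, szy, szx, sxz]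
  · have h0 := nx_cases n (n - 2)
    have h1 := nx_cases n (n - 2)
    unfold S qz fXX
    split_ifs <;> first | (exfalso; omega) | simp [sxx, syy, szz, sxy, syx, syz, szy, szx, sxz]
  · intro i hin hi
    have h0 := nx_cases n (n - 2)
    have h1 := nx_cases n i
    unfold S qz fXX
    split_ifs <;> first | (exfalso; omega) | simp [sxx, syy, szz, sxy, syx, syz, szy, szx, sxz]

lemma b_xx2 {n : ℕ} (hn : 3 ≤ n) :
    ⁅kr n (fXX n), kr n (qz n (n - 1))⁆ = (2 * Complex.I) • kr n (S sy sz (n - 2)) := by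
  refine kr_lie _ _ _ (0) (Complex.I) (by omega) ?_ ?_ ?_
  · have h0 := nx_cases n (n - 1)
    unfold S qz fXX
    split_ifs <;> first | (exfalso; omega) | simp [sxx, syy, szz, sxy, syx, syz, szy, szx, sxz]
  · have h0 := nx_cases n (n - 1)
    unfold S qz fXX
    split_ifs <;> first | (exfalso; omega) | simp [sxx, syy, szz, sxy, syx, syz, szy, szx, sxz]
  · intro i hin hi
    have h0 := nx_cases n (n - 1)
    unfold S qz fXX
    split_ifs <;> first | (exfalso; omega) | simp [sxx, syy, szz, sxy, syx, syz, szy, szx, sxz]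

set_option maxHeartbeats 2000000 in
lemma v_yy {n : ℕ} (hn : 3 ≤ n) (j : ℕ) (hj : j ≤ n - 3) (m : ℕ) (hm : m < n) (h1 : m ≠ n - 1) (h2 : m ≠ j + 1) :
    ⁅kr n (S sy sy j), kr n (qz n m)⁆ = 0 := by
  apply bond_zero hn _ m hm
  have h0 := nx_cases n m
  unfold S
  split_ifs <;> first | (exfalso; omega) | (left; simp; done) | (right; simp [sxx, syy, szz, sxy, syx, syz, szy, szx, sxz]; done)

set_option maxHeartbeats 2000000 in
lemma v_yy' {n : ℕ} (hn : 3 ≤ n) (m : ℕ) (hm : m < n) :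
    ⁅kr n (S sy sy (n - 2)), kr n (qz n m)⁆ = 0 := by
  apply bond_zero hn _ m hm
  have h0 := nx_cases n m
  unfold S
  split_ifs <;> first | (exfalso; omega) | (left; simp; done) | (right; simp [sxx, syy, szz, sxy, syx, syz, szy, szx, sxz]; done)

set_option maxHeartbeats 2000000 in
lemma v_zz {n : ℕ} (hn : 3 ≤ n) (j : ℕ) (hj1 : 1 ≤ j) (hj : j ≤ n - 2) (m : ℕ) (hm : m < n) (h1 : m ≠ 0) (h2 : m ≠ j) :
    ⁅kr n (S sz sz j), kr n (qz n m)⁆ = 0 := by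
  apply bond_zero hn _ m hm
  have h0 := nx_cases n m
  unfold S
  split_ifs <;> first | (exfalso; omega) | (left; simp; done) | (right; simp [sxx, syy, szz, sxy, syx, syz, szy, szx, sxz]; done)

set_option maxHeartbeats 2000000 in
lemma v_zy {n : ℕ} (hn : 3 ≤ n) (j : ℕ) (hj : j ≤ n - 2) (m : ℕ) (hm : m < n) (h1 : m ≠ 0) (h2 : m ≠ j + 1) :
    ⁅kr n (S sz sy j), kr n (qz n m)⁆ = 0 := by
  apply bond_zero hn _ m hm
  have h0 := nx_cases n m
  unfold S
  split_ifs <;> first | (exfalso; omega) | (left; simp; done) | (right; simp [sxx, syy, szz, sxy, syx, syz, szy, szx, sxz]; done)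

set_option maxHeartbeats 2000000 in
lemma v_yz {n : ℕ} (hn : 3 ≤ n) (j : ℕ) (hj : j ≤ n - 2) (m : ℕ) (hm : m < n) (h1 : m ≠ n - 1) (h2 : m ≠ j) :
    ⁅kr n (S sy sz j), kr n (qz n m)⁆ = 0 := by
  apply bond_zero hn _ m hm
  have h0 := nx_cases n m
  unfold S
  split_ifs <;> first | (exfalso; omega) | (left; simp; done) | (right; simp [sxx, syy, szz, sxy, syx, syz, szy, szx, sxz]; done)

set_option maxHeartbeats 2000000 in
lemma v_x {n : ℕ} (hn : 3 ≤ n) (m : ℕ) (hm : m < n) (h1 : m ≠ n - 1) (h2 : m ≠ 0) :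
    ⁅kr n (qx 0), kr n (qz n m)⁆ = 0 := by
  apply bond_zero hn _ m hm
  have h0 := nx_cases n m
  unfold qx
  split_ifs <;> first | (exfalso; omega) | (left; simp; done) | (right; simp [sxx, syy, szz, sxy, syx, syz, szy, szx, sxz]; done)

set_option maxHeartbeats 2000000 in
lemma v_xx {n : ℕ} (hn : 3 ≤ n) (m : ℕ) (hm : m < n) (h1 : m ≠ n - 2) (h2 : m ≠ n - 1) :
    ⁅kr n (fXX n), kr n (qz n m)⁆ = 0 := by
  apply bond_zero hn _ m hm
  have h0 := nx_cases n m
  unfold fXX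
  split_ifs <;> first | (exfalso; omega) | (left; simp; done) | (right; simp [sxx, syy, szz, sxy, syx, syz, szy, szx, sxz]; done)

/-- The symmetrized two-term commutator with `Z^0`. -/
lemma lieZ {n : ℕ} (hn : 3 ≤ n) (f ga gb : ℕ → Matrix (Fin 2) (Fin 2) ℂ) (a b : ℕ) (ca cb : ℂ)
    (ha : a < n) (hb : b < n) (hab : a ≠ b)
    (hA : ⁅kr n f, kr n (qz n a)⁆ = ca • kr n ga) (hB : ⁅kr n f, kr n (qz n b)⁆ = cb • kr n gb)
    (h : ∀ m < n, m ≠ a → m ≠ b → ⁅kr n f, kr n (qz n m)⁆ = 0) :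
    ⁅Complex.I • symmC (kr n f), Z n 0⁆ = -(ca • symmC (kr n ga) + cb • symmC (kr n gb)) := by
  rw [Z, lie_symmC (by omega), symmC_z hn, two_terms (kr n f) (fun m => kr n (qz n m)) a b ha hb hab _ _ hA hB h, symmC_add,
    symmC_smul, symmC_smul]

lemma snx {n : ℕ} (hn : 3 ≤ n) (f : ℕ → Matrix (Fin 2) (Fin 2) ℂ) :
    symmC (kr n (fun i => f (nx n i))) = symmC (kr n f) := symmC_nx (by omega) f

lemma spv {n : ℕ} (hn : 3 ≤ n) (f : ℕ → Matrix (Fin 2) (Fin 2) ℂ) :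
    symmC (kr n (fun i => f (pv n i))) = symmC (kr n f) := symmC_pv (by omega) f

/-- The commutation table of the basis elements with the two
generators `X` and `Z^0` (Table I of the paper). -/
theorem stmt9 (n : ℕ) (hn : 3 ≤ n) :
    (∀ j ≤ n - 2, ⁅Y n j, X n⁆ = (-2 : ℂ) • YZ n j) ∧
    (∀ j ≤ n - 2, ⁅Z n j, X n⁆ = (2 : ℂ) • YZ n j) ∧
    (∀ j ≤ n - 3, ⁅Y n j, Z n 0⁆ = (2 : ℂ) • YZ n (j + 1)) ∧
    ⁅Y n (n - 2), Z n 0⁆ = 0 ∧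
    (∀ j, 1 ≤ j → j ≤ n - 2 → ⁅Z n j, Z n 0⁆ = (-2 : ℂ) • YZ n (j - 1)) ∧
    ⁅Z n 0, Z n 0⁆ = 0 ∧
    (∀ j ≤ n - 2, ⁅YZ n j, X n⁆ = (-4 : ℂ) • Z n j + (4 : ℂ) • Y n j) ∧
    (∀ j ≤ n - 2, ⁅YZ n j, Z n 0⁆ =
      (4 : ℂ) • ((if j = 0 then X n else 0) - (if j = 0 then 0 else Y n (j - 1)) +
        (if j = n - 2 then XX n else 0) + (if j = n - 2 then 0 else Z n (j + 1)))) ∧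
    ⁅X n, X n⁆ = 0 ∧
    ⁅XX n, X n⁆ = 0 ∧
    ⁅X n, Z n 0⁆ = (-2 : ℂ) • YZ n 0 ∧
    ⁅XX n, Z n 0⁆ = (-2 : ℂ) • YZ n (n - 2) := by
  have hXX : XX n = Complex.I • symmC (kr n (fXX n)) := rfl
  have hX : X n = Complex.I • symmC (kr n (qx 0)) := rfl
  have hI : Complex.I * Complex.I = -1 := Complex.I_mul_I
  refine ⟨?_, ?_, ?_, ?_, ?_, lie_self _, ?_, ?_, lie_self _, ?_, ?_, ?_⟩
  · intro j hj
    rw [Y, YZ, lieX hn j hj sy sy sz sz _ _ syx sxy syx sxy]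
    module
  · intro j hj
    rw [Z, YZ, lieX hn j hj sz sz sy sy (-Complex.I) (-Complex.I) szx (by simp [sxz])
      szx (by simp [sxz])]
    module
  · intro j hj
    rw [Y, YZ, str_eq, lieZ hn _ _ _ (n - 1) (j + 1) _ _ (by omega) (by omega) (by omega) (b_yy1 hn j hj)
      (b_yy2 hn j hj) (v_yy hn j hj), snx hn]
    simp only [str_eq]
    module
  · rw [Y, Z, str_eq, lie_symmC (by omega), symmC_z hn, lie_sum,
      Finset.sum_eq_zero (fun m hm => v_yy' hn m (Finset.mem_range.1 hm)), symmC_zero, neg_zero]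
  · intro j hj1 hj
    rw [Z, YZ, str_eq, lieZ hn _ _ _ _ _ _ _ (by omega) (by omega) (by omega) (b_zz1 hn j hj1 hj)
      (b_zz2 hn j hj1 hj) (v_zz hn j hj1 hj), spv hn]
    simp only [str_eq]
    module
  · intro j hj
    rw [YZ, add_lie, lieX hn j hj sz sy sy sz (-Complex.I) Complex.I szx (by simp [sxz]) syx sxy,
      lieX hn j hj sy sz sz sy Complex.I (-Complex.I) syx sxy szx (by simp [sxz]), Y, Z]
    module
  · intro j hj
    rw [YZ, add_lie, str_eq, str_eq]
    rcases Nat.eq_zero_or_pos j with rfl | hj1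
    · have h2 : ¬ (0 = n - 2) := by omega
      rw [lieZ hn _ _ _ _ _ _ _ (by omega) (by omega) (by omega) (b_zy1 hn)
        (b_zy3 hn 0 (by omega)) (v_zy hn 0 hj),
        lieZ hn _ _ _ _ _ _ _ (by omega) (by omega) (by omega) (b_yz3 hn 0 (by omega))
        (b_yz1 hn) (v_yz hn 0 hj), spv hn, snx hn, hX, Z, str_eq]
      simp only [if_true, if_neg h2]
      module
    · have h1 : ¬ (j = 0) := by omega
      by_cases h2 : j = n - 2
      · have h3 : j + 1 = n - 1 := by omega
        rw [lieZ hn _ _ _ 0 (n - 1) _ _ (by omega) (by omega) (by omega) (b_zy2 hn j hj1 hj)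
          (by rw [h2]; exact b_zy4 hn) (fun m hm ha hb => v_zy hn j hj m hm ha (by omega)),
          lieZ hn _ _ _ (n - 1) j _ _ (by omega) (by omega) (by omega) (by rw [h2]; exact b_yz4 hn)
          (b_yz2 hn j hj1 hj) (v_yz hn j hj), spv hn, spv hn, hXX, Y, str_eq]
        simp only [if_neg h1, if_pos h2]
        module
      · rw [lieZ hn _ _ _ _ _ _ _ (by omega) (by omega) (by omega) (b_zy2 hn j hj1 hj)
          (b_zy3 hn j (by omega)) (v_zy hn j hj),
          lieZ hn _ _ _ _ _ _ _ (by omega) (by omega) (by omega) (b_yz3 hn j (by omega))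
          (b_yz2 hn j hj1 hj) (v_yz hn j hj), spv hn, snx hn, Y, Z, str_eq, str_eq]
        simp only [if_neg h1, if_neg h2]
        module
  · rw [hXX, hX, lie_symmC (by omega), symmC_x hn, lie_sum, Finset.sum_eq_zero, symmC_zero,
      neg_zero]
    intro m _
    apply kr_lie_comm
    intro i _
    unfold fXX qx
    split_ifs <;> simp
  · rw [hX, YZ, lieZ hn _ _ _ _ _ _ _ (by omega) (by omega) (by omega) (b_x1 hn)
      (b_x2 hn) (v_x hn), snx hn]
    simp only [str_eq]
    module
  · rw [hXX, YZ, lieZ hn _ _ _ _ _ _ _ (by omega) (by omega) (by omega) (b_xx1 hn)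
      (b_xx2 hn) (v_xx hn), snx hn]
    simp only [str_eq]
    module

end
end Ising
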